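/- arXiv:2210.08597 — 3 statements merged into one kernel-verified Lean document; each statement's English description precedes it below -/
import Mathlib

section
/- For all points p, q in the open upper unit hemisphere of ℝ³, the spherical (geodesic) distance arccos⟨p,q⟩ is at most the Euclidean distance of the gnomonic images: arccos⟨p,q⟩ ≤ ‖π(p) − π(q)‖. (Claim 2 of Lemma D, spherical case κ > 0: the ratio of spherical distance to projected Euclidean distance is at most 1.) -/
open RealInnerProductSpace

/-- The gnomonic projection from the open upper unit hemisphere of `ℝ³` onto the
plane tangent to the sphere at the pole `(0,0,1)`, in coordinates. -/
noncomputable def gnomonic (x : EuclideanSpace ℝ (Fin 3)) : EuclideanSpace ℝ (Fin 2) :=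
  !₂[x 0 / x 2, x 1 / x 2]

/-- The half-angle estimate `tan (d / 2) ≥ d / 2`, rewritten for `arccos`. -/
theorem arccos_le_of_half_angle_le {c d : ℝ} (hd : 0 ≤ d)
    (h : (4 - d ^ 2) / (4 + d ^ 2) ≤ c) : Real.arccos c ≤ d := by
  rcases le_total Real.pi d with hpi | hpi
  · exact (Real.arccos_le_pi c).trans hpi
  have hcos : Real.cos (d / 2) ≤ 1 / √((d / 2) ^ 2 + 1) :=
    Real.cos_le_one_div_sqrt_sq_add_one (by linarith) (by linarith)
  have hcos0 : 0 ≤ Real.cos (d / 2) :=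
    Real.cos_nonneg_of_neg_pi_div_two_le_of_le (by linarith) (by linarith)
  have hsq : Real.cos (d / 2) ^ 2 ≤ 1 / ((d / 2) ^ 2 + 1) := by
    have := pow_le_pow_left₀ hcos0 hcos 2
    rwa [div_pow, one_pow, Real.sq_sqrt (by positivity)] at this
  have hdouble : Real.cos d = 2 * Real.cos (d / 2) ^ 2 - 1 := by
    rw [← Real.cos_two_mul, mul_div_cancel₀ d two_ne_zero]
  have heq : 2 * (1 / ((d / 2) ^ 2 + 1)) - 1 = (4 - d ^ 2) / (4 + d ^ 2) := by
    field_simp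
    ring
  calc Real.arccos c ≤ Real.arccos (Real.cos d) := Real.arccos_le_arccos (by linarith)
    _ = d := Real.arccos_cos hd hpi

/-- If `s` is the product of the heights of the points of the unit hemisphere lying over
`(a₁, a₂)` and `(b₁, b₂)`, then `s * (1 + a₁ * b₁ + a₂ * b₂)` is the cosine of their spherical
distance; it is at least the cosine of twice the arctangent of half the planar distance `d`. -/
theorem half_angle_le_cos_gnomonic {a₁ a₂ b₁ b₂ s d : ℝ} (hs : 0 < s)
    (hs2 : s ^ 2 * ((1 + a₁ ^ 2 + a₂ ^ 2) * (1 + b₁ ^ 2 + b₂ ^ 2)) = 1)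
    (hd : d ^ 2 = (a₁ - b₁) ^ 2 + (a₂ - b₂) ^ 2) :
    (4 - d ^ 2) / (4 + d ^ 2) ≤ s * (1 + a₁ * b₁ + a₂ * b₂) := by
  generalize d ^ 2 = e at *
  have he : 0 ≤ e := by rw [hd]; positivity
  rw [div_le_iff₀ (by linarith)]
  set w := 1 + a₁ * b₁ + a₂ * b₂ with hw
  have hw_lower : (4 - e) / 4 ≤ w := by
    rw [hd, hw]
    nlinarith [sq_nonneg (a₁ + b₁), sq_nonneg (a₂ + b₂)]
  rcases le_total (s * (4 + e)) 4 with hm | hm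
  · -- Here the arithmetic-geometric mean inequality suffices.
    have hamgm : 1 ≤ s * (w + e / 2) := by
      have h0 : 0 < w + e / 2 := by linarith
      have hsum : w + e / 2 = ((1 + a₁ ^ 2 + a₂ ^ 2) + (1 + b₁ ^ 2 + b₂ ^ 2)) / 2 := by
        rw [hd, hw]; ring
      have : 1 ≤ (s * (w + e / 2)) ^ 2 := by
        rw [← hs2, mul_pow, hsum]
        refine mul_le_mul_of_nonneg_left ?_ (sq_nonneg s)
        nlinarith [sq_nonneg ((1 + a₁ ^ 2 + a₂ ^ 2) - (1 + b₁ ^ 2 + b₂ ^ 2))]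
      nlinarith [mul_pos hs h0]
    nlinarith
  · rcases le_total e 4 with h4 | h4
    · nlinarith [mul_le_mul_of_nonneg_left hw_lower hs.le]
    · rcases le_total 0 w with h0 | h0
      · have : 0 ≤ s * w * (4 + e) := by positivity
        linarith
      · -- The cosine is negative; bound the sine below by Lagrange's identity.
        have hlag : s ^ 2 * (w ^ 2 + e) ≤ 1 := by
          rw [← hs2]
          refine mul_le_mul_of_nonneg_left ?_ (sq_nonneg s)
          rw [hd, hw]
          nlinarith [sq_nonneg (a₁ * b₂ - a₂ * b₁)]
        have hw2 : w ^ 2 ≤ ((e - 4) / 4) ^ 2 := by nlinarith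
        have hsq : (-(s * w) * (4 + e)) ^ 2 ≤ (e - 4) ^ 2 := by
          have h1 : w ^ 2 * (4 + e) ^ 2 ≤ (e - 4) ^ 2 * (w ^ 2 + e) := by nlinarith
          nlinarith [mul_le_mul_of_nonneg_left h1 (sq_nonneg s),
            mul_le_mul_of_nonneg_left hlag (sq_nonneg (e - 4))]
        have := le_of_abs_le (abs_le_of_sq_le_sq hsq (by linarith))
        linarith

/-- For points `p, q` in the open upper unit hemisphere, the spherical distance
`arccos ⟪p,q⟫` is at most the Euclidean distance of the gnomonic images. -/
theorem sphericalDist_le_gnomonic_dist (p q : EuclideanSpace ℝ (Fin 3))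
    (hp1 : ‖p‖ = 1) (hp2 : 0 < p 2) (hq1 : ‖q‖ = 1) (hq2 : 0 < q 2) :
    Real.arccos ⟪p, q⟫ ≤ ‖gnomonic p - gnomonic q‖ := by
  apply arccos_le_of_half_angle_le (norm_nonneg _)
  have height (x : EuclideanSpace ℝ (Fin 3)) (hx1 : ‖x‖ = 1) (hx2 : 0 < x 2) :
      x 2 ^ 2 * (1 + (x 0 / x 2) ^ 2 + (x 1 / x 2) ^ 2) = 1 := by
    have h : x 0 ^ 2 + x 1 ^ 2 + x 2 ^ 2 = 1 := by
      rw [← Fin.sum_univ_three (fun i => x i ^ 2), ← EuclideanSpace.real_norm_sq_eq, hx1, one_pow]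
    field_simp
    linarith
  have hinner : ⟪p, q⟫ =
      p 2 * q 2 * (1 + p 0 / p 2 * (q 0 / q 2) + p 1 / p 2 * (q 1 / q 2)) := by
    simp only [PiLp.inner_apply, Fin.sum_univ_three, RCLike.inner_apply, conj_trivial]
    field_simp
    ring
  rw [hinner]
  apply half_angle_le_cos_gnomonic (mul_pos hp2 hq2)
  · linear_combination height p hp1 hp2 * (q 2 ^ 2 * (1 + (q 0 / q 2) ^ 2 + (q 1 / q 2) ^ 2)) +
      height q hq1 hq2
  · simp [EuclideanSpace.real_norm_sq_eq, gnomonic]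
end

section
/- For every δ ∈ (0,1) there exists ε > 0 such that for all points p, q in the open upper unit hemisphere of ℝ³ with arccos(p₃) < ε and arccos(q₃) < ε (i.e. within spherical distance ε of the pole N = (0,0,1)), one has (1 − δ)·‖π(p) − π(q)‖ ≤ arccos⟨p,q⟩. (Claim 2 of Lemma D, spherical case: the ratio of spherical distance to projected Euclidean distance approaches 1 from below as points approach the pole.) -/
open RealInnerProductSpace

/-- On the upper half-space, the gnomonic distance scaled by the heights is bounded by the
sine of the angle between unit vectors (the norm of their cross product). -/
theorem mul_norm_gnomonic_sub_le_sqrt (p q : EuclideanSpace ℝ (Fin 3))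
    (hp : ‖p‖ = 1) (hp2 : 0 < p 2) (hq : ‖q‖ = 1) (hq2 : 0 < q 2) :
    p 2 * q 2 * ‖gnomonic p - gnomonic q‖ ≤ √(1 - ⟪p, q⟫ ^ 2) := by
  have hp' : p 0 ^ 2 + p 1 ^ 2 + p 2 ^ 2 = 1 := by
    have h := EuclideanSpace.real_norm_sq_eq p
    rw [hp, Fin.sum_univ_three] at h
    linarith
  have hq' : q 0 ^ 2 + q 1 ^ 2 + q 2 ^ 2 = 1 := by
    have h := EuclideanSpace.real_norm_sq_eq q
    rw [hq, Fin.sum_univ_three] at h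
    linarith
  have hinner : ⟪p, q⟫ = p 0 * q 0 + p 1 * q 1 + p 2 * q 2 := by
    simp [PiLp.inner_apply, Fin.sum_univ_three, mul_comm]
  have hsq : (p 2 * q 2 * ‖gnomonic p - gnomonic q‖) ^ 2 =
      (p 0 * q 2 - q 0 * p 2) ^ 2 + (p 1 * q 2 - q 1 * p 2) ^ 2 := by
    rw [mul_pow, EuclideanSpace.real_norm_sq_eq, Fin.sum_univ_two]
    simp only [gnomonic, PiLp.sub_apply, Matrix.cons_val_zero, Matrix.cons_val_one]
    field_simp
  have hlagrange : 1 - (p 0 * q 0 + p 1 * q 1 + p 2 * q 2) ^ 2 =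
      (p 0 * q 2 - q 0 * p 2) ^ 2 + (p 1 * q 2 - q 1 * p 2) ^ 2 +
        (p 0 * q 1 - q 0 * p 1) ^ 2 := by
    linear_combination (-(q 0 ^ 2 + q 1 ^ 2 + q 2 ^ 2)) * hp' - hq'
  apply Real.le_sqrt_of_sq_le
  rw [hsq, hinner, hlagrange]
  exact le_add_of_nonneg_right (sq_nonneg _)

/-- For every `δ ∈ (0,1)` there is `ε > 0` such that for points `p, q` of the open upper
unit hemisphere within spherical distance `ε` of the pole `(0,0,1)`, the spherical
distance `arccos ⟪p,q⟫` is at least `(1 - δ)` times the Euclidean distance of the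
gnomonic images. -/
theorem sphericalDist_ge_gnomonic_dist_near_pole (δ : ℝ) (hδ0 : 0 < δ) (hδ1 : δ < 1) :
    ∃ ε > 0, ∀ p q : EuclideanSpace ℝ (Fin 3),
      ‖p‖ = 1 → 0 < p 2 → ‖q‖ = 1 → 0 < q 2 →
      Real.arccos (p 2) < ε → Real.arccos (q 2) < ε →
      (1 - δ) * ‖gnomonic p - gnomonic q‖ ≤ Real.arccos ⟪p, q⟫ := by
  refine ⟨Real.arccos √(1 - δ), Real.arccos_pos.2 ?_, ?_⟩
  · rw [Real.sqrt_lt' one_pos]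
    linarith
  intro p q hp hp2 hq hq2 hpε hqε
  have hheight {t : ℝ} (ht : Real.arccos t < Real.arccos √(1 - δ)) : √(1 - δ) ≤ t :=
    (Real.antitone_arccos.reflect_lt ht).le
  have hδ : 1 - δ ≤ p 2 * q 2 := by
    rw [← Real.mul_self_sqrt (sub_nonneg.2 hδ1.le)]
    exact mul_le_mul (hheight hpε) (hheight hqε) (Real.sqrt_nonneg _) hp2.le
  calc (1 - δ) * ‖gnomonic p - gnomonic q‖
      ≤ p 2 * q 2 * ‖gnomonic p - gnomonic q‖ := by gcongr
    _ ≤ √(1 - ⟪p, q⟫ ^ 2) := mul_norm_gnomonic_sub_le_sqrt p q hp hp2 hq hq2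
    _ = Real.sin (Real.arccos ⟪p, q⟫) := (Real.sin_arccos _).symm
    _ ≤ Real.arccos ⟪p, q⟫ := Real.sin_le (Real.arccos_nonneg _)
end

section
/- For every δ > 0 there exists ε > 0 with the following property: for all points A, B, C in the open upper unit hemisphere of ℝ³ with A ≠ B, C ≠ B, and arccos(A₃) < ε, arccos(B₃) < ε, arccos(C₃) < ε, the spherical angle at B between A and C, defined as the angle between the tangent vectors A − ⟨A,B⟩B and C − ⟨C,B⟩B, differs from the Euclidean angle ∠ π(A) π(B) π(C) by strictly less than δ. (Claim 1 of Lemma D, spherical case: the gnomonic projection distorts angles arbitrarily little near the pole.) -/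
open RealInnerProductSpace

/-- The spherical angle at `B` between `A` and `C`, i.e. the angle between the
tangent vectors `A - ⟪A,B⟫ • B` and `C - ⟪C,B⟫ • B`. -/
noncomputable def sphericalAngle (A B C : EuclideanSpace ℝ (Fin 3)) : ℝ :=
  InnerProductGeometry.angle (A - ⟪A, B⟫ • B) (C - ⟪C, B⟫ • B)

open InnerProductGeometry in
/-- If the component of `U` along the unit vector `B` is small relative to `U`, then `U` makes
a small angle with its projection onto the orthogonal complement of `B`. -/
theorem angle_sub_inner_smul_le_arccos {V : Type*} [NormedAddCommGroup V] [InnerProductSpace ℝ V]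
    {U B : V} {c : ℝ} (hB : ‖B‖ = 1) (hc : 0 < c) (hU : U ≠ 0)
    (h : ⟪U, B⟫ ^ 2 ≤ (1 - c ^ 2) * ‖U‖ ^ 2) :
    angle U (U - ⟪U, B⟫ • B) ≤ Real.arccos c := by
  have hUpos : 0 < ‖U‖ := norm_pos_iff.mpr hU
  have hinner : ⟪U, U - ⟪U, B⟫ • B⟫ = ‖U‖ ^ 2 - ⟪U, B⟫ ^ 2 := by
    rw [inner_sub_right, inner_smul_right, real_inner_self_eq_norm_sq]
    ring
  have hnorm : ‖U - ⟪U, B⟫ • B‖ ^ 2 = ‖U‖ ^ 2 - ⟪U, B⟫ ^ 2 := by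
    rw [norm_sub_sq_real, norm_smul, inner_smul_right, hB, mul_one, Real.norm_eq_abs, sq_abs]
    ring
  have hle : c * ‖U‖ ≤ ‖U - ⟪U, B⟫ • B‖ :=
    le_of_sq_le_sq (by rw [hnorm, mul_pow]; linarith) (norm_nonneg _)
  have hpos : 0 < ‖U - ⟪U, B⟫ • B‖ := (mul_pos hc hUpos).trans_le hle
  refine Real.arccos_le_arccos ?_
  rw [hinner, ← hnorm, le_div_iff₀ (mul_pos hUpos hpos)]
  nlinarith

open InnerProductGeometry in
/-- Projecting two vectors onto the orthogonal complement of `B`, each having a small component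
along the unit vector `B`, changes the angle between them only slightly. -/
theorem abs_angle_sub_inner_smul_sub_angle_le {V : Type*} [NormedAddCommGroup V]
    [InnerProductSpace ℝ V] {U W B : V} {c : ℝ} (hB : ‖B‖ = 1) (hc : 0 < c)
    (hU : ⟪U, B⟫ ^ 2 ≤ (1 - c ^ 2) * ‖U‖ ^ 2) (hW : ⟪W, B⟫ ^ 2 ≤ (1 - c ^ 2) * ‖W‖ ^ 2) :
    |angle (U - ⟪U, B⟫ • B) (W - ⟪W, B⟫ • B) - angle U W| ≤ 2 * Real.arccos c := by
  have hnonneg := Real.arccos_nonneg c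
  rcases eq_or_ne U 0 with rfl | hU0
  · simpa using hnonneg
  rcases eq_or_ne W 0 with rfl | hW0
  · simpa using hnonneg
  have hUangle := angle_sub_inner_smul_le_arccos hB hc hU0 hU
  have hWangle := angle_sub_inner_smul_le_arccos hB hc hW0 hW
  set projU := U - ⟪U, B⟫ • B
  set projW := W - ⟪W, B⟫ • B
  rw [abs_le]
  constructor
  · linarith [angle_le_angle_add_angle U projU W, angle_le_angle_add_angle projU projW W,
      angle_comm W projW]
  · linarith [angle_le_angle_add_angle projU U projW, angle_le_angle_add_angle U W projW,
      angle_comm U projU]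

/-- The horizontal vector of `ℝ³` joining the central projections of `B` and `A` to the plane
tangent to the sphere at the pole. -/
noncomputable def gnomonicDisplacement (A B : EuclideanSpace ℝ (Fin 3)) :
    EuclideanSpace ℝ (Fin 3) :=
  (A 2)⁻¹ • A - (B 2)⁻¹ • B

theorem gnomonicDisplacement_two {A B : EuclideanSpace ℝ (Fin 3)} (hA : A 2 ≠ 0) (hB : B 2 ≠ 0) :
    gnomonicDisplacement A B 2 = 0 := by
  simp [gnomonicDisplacement, hA, hB]

theorem inner_gnomonicDisplacement {A B C : EuclideanSpace ℝ (Fin 3)}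
    (hA : A 2 ≠ 0) (hB : B 2 ≠ 0) :
    ⟪gnomonicDisplacement A B, gnomonicDisplacement C B⟫ =
      ⟪gnomonic A - gnomonic B, gnomonic C - gnomonic B⟫ := by
  simp only [PiLp.inner_apply, Fin.sum_univ_three, Fin.sum_univ_two,
    gnomonicDisplacement_two hA hB]
  simp [gnomonicDisplacement, gnomonic, div_eq_inv_mul]

theorem angle_gnomonicDisplacement {A B C : EuclideanSpace ℝ (Fin 3)}
    (hA : A 2 ≠ 0) (hB : B 2 ≠ 0) (hC : C 2 ≠ 0) :
    InnerProductGeometry.angle (gnomonicDisplacement A B) (gnomonicDisplacement C B) =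
      EuclideanGeometry.angle (gnomonic A) (gnomonic B) (gnomonic C) := by
  simp only [EuclideanGeometry.angle, InnerProductGeometry.angle, vsub_eq_sub,
    norm_eq_sqrt_real_inner, inner_gnomonicDisplacement hA hB, inner_gnomonicDisplacement hC hB]

theorem gnomonicDisplacement_sub_inner_smul (A : EuclideanSpace ℝ (Fin 3))
    {B : EuclideanSpace ℝ (Fin 3)} (hB : ‖B‖ = 1) :
    gnomonicDisplacement A B - ⟪gnomonicDisplacement A B, B⟫ • B =
      (A 2)⁻¹ • (A - ⟪A, B⟫ • B) := by
  rw [gnomonicDisplacement, inner_sub_left, real_inner_smul_left, real_inner_smul_left,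
    real_inner_self_eq_norm_sq, hB]
  module

theorem sphericalAngle_eq_angle_gnomonicDisplacement {A B C : EuclideanSpace ℝ (Fin 3)}
    (hA : 0 < A 2) (hB : ‖B‖ = 1) (hC : 0 < C 2) :
    sphericalAngle A B C =
      InnerProductGeometry.angle
        (gnomonicDisplacement A B - ⟪gnomonicDisplacement A B, B⟫ • B)
        (gnomonicDisplacement C B - ⟪gnomonicDisplacement C B, B⟫ • B) := by
  rw [gnomonicDisplacement_sub_inner_smul A hB, gnomonicDisplacement_sub_inner_smul C hB,
    InnerProductGeometry.angle_smul_left_of_pos _ _ (inv_pos.mpr hA),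
    InnerProductGeometry.angle_smul_right_of_pos _ _ (inv_pos.mpr hC), sphericalAngle]

/-- Cauchy–Schwarz for the horizontal parts of a horizontal vector and a unit vector. -/
theorem sq_inner_le_of_apply_two_eq_zero {U B : EuclideanSpace ℝ (Fin 3)} (hU : U 2 = 0)
    (hB : ‖B‖ = 1) : ⟪U, B⟫ ^ 2 ≤ (1 - B 2 ^ 2) * ‖U‖ ^ 2 := by
  have hsq : B 0 ^ 2 + B 1 ^ 2 + B 2 ^ 2 = 1 := by
    simpa [hB, Fin.sum_univ_three] using (EuclideanSpace.real_norm_sq_eq B).symm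
  rw [EuclideanSpace.real_norm_sq_eq, ← hsq]
  simp only [PiLp.inner_apply, Fin.sum_univ_three, hU, RCLike.inner_apply, conj_trivial]
  nlinarith [sq_nonneg (U 0 * B 1 - U 1 * B 0)]

/-- Claim 1 of Lemma D (spherical case): for every `δ > 0` there is `ε > 0` such that
for all points `A, B, C` of the open upper unit hemisphere within spherical distance
`ε` of the pole (with `A ≠ B`, `C ≠ B`), the spherical angle at `B` differs from the
Euclidean angle `∠ π(A) π(B) π(C)` of the gnomonic images by strictly less than `δ`. -/
theorem gnomonic_angle_distortion (δ : ℝ) (hδ : 0 < δ) :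
    ∃ ε > 0, ∀ A B C : EuclideanSpace ℝ (Fin 3),
      ‖A‖ = 1 → 0 < A 2 → ‖B‖ = 1 → 0 < B 2 → ‖C‖ = 1 → 0 < C 2 →
      A ≠ B → C ≠ B →
      Real.arccos (A 2) < ε → Real.arccos (B 2) < ε → Real.arccos (C 2) < ε →
      |sphericalAngle A B C -
        EuclideanGeometry.angle (gnomonic A) (gnomonic B) (gnomonic C)| < δ := by
  refine ⟨δ / 2, half_pos hδ, fun A B C _ hA hB hB2 _ hC _ _ _ hBε _ => ?_⟩
  rw [sphericalAngle_eq_angle_gnomonicDisplacement hA hB hC,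
    ← angle_gnomonicDisplacement hA.ne' hB2.ne' hC.ne']
  have hle := abs_angle_sub_inner_smul_sub_angle_le hB hB2
    (sq_inner_le_of_apply_two_eq_zero (gnomonicDisplacement_two hA.ne' hB2.ne') hB)
    (sq_inner_le_of_apply_two_eq_zero (gnomonicDisplacement_two hC.ne' hB2.ne') hB)
  linarith
end
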